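/- arXiv:2003.12801 — 2 statements merged into one kernel-verified Lean document; each statement's English description precedes it below -/
import Mathlib

section
/- Let (x_i)_{i=1}^∞ be a uniqueness set for H with {K_{x_i}}_{i=1}^∞ linearly independent, and let Γ^N be the inverse of the Gram matrix G^N = [K(x_j, x_i)]_{i,j=1}^N. Let (y_i)_{i=1}^∞ be a sequence in F such that sup_{N∈ℕ} Σ_{i=1}^N Σ_{j=1}^N y_i Γ^N_{ij} conj(y_j) < ∞. Then there exists a unique F̂ ∈ H such that F̂(x_i) = y_i for all i ∈ ℕ. -/
open scoped InnerProductSpace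

/-- If the `v i` are linearly independent, a finite system `⟪v i, f⟫ = y i` has a solution in the
span of the `v i`, whose squared norm is the quadratic form of the inverse transposed Gram
matrix at `y`. -/
theorem exists_mem_span_inner_eq_of_linearIndependent {𝕜 H ι : Type*} [RCLike 𝕜]
    [NormedAddCommGroup H] [InnerProductSpace 𝕜 H] [Fintype ι] [DecidableEq ι]
    {v : ι → H} (hv : LinearIndependent 𝕜 v) (y : ι → 𝕜) :
    ∃ f ∈ Submodule.span 𝕜 (Set.range v), (∀ i, ⟪v i, f⟫_𝕜 = y i) ∧
      ‖f‖ ^ 2 = RCLike.re (∑ i, ∑ j, y i * (Matrix.of fun i j => ⟪v j, v i⟫_𝕜)⁻¹ i j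
        * (starRingEnd 𝕜) (y j)) := by
  set A : Matrix ι ι 𝕜 := Matrix.of fun i j => ⟪v j, v i⟫_𝕜 with hA
  have hdet : IsUnit A.det := by
    have hT : A = (Matrix.gram 𝕜 v).transpose := rfl
    rw [hT, Matrix.det_transpose, isUnit_iff_ne_zero]
    exact (Matrix.posSemidef_gram 𝕜 v).posDef_iff_det_ne_zero.mp
      (Matrix.posDef_gram_of_linearIndependent hv)
  set d : ι → 𝕜 := A⁻¹.mulVec (fun j => (starRingEnd 𝕜) (y j)) with hd
  have hAd : A.mulVec d = fun j => (starRingEnd 𝕜) (y j) := by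
    rw [hd, Matrix.mulVec_mulVec, Matrix.mul_nonsing_inv _ hdet, Matrix.one_mulVec]
  have hinner : ∀ i, ⟪v i, ∑ j, (starRingEnd 𝕜) (d j) • v j⟫_𝕜 = y i := fun i => by
    have h := congrArg (starRingEnd 𝕜) (congrFun hAd i)
    simp only [Matrix.mulVec, dotProduct, hA, Matrix.of_apply, map_sum, map_mul,
      inner_conj_symm, RCLike.conj_conj] at h
    rw [inner_sum, ← h]
    exact Finset.sum_congr rfl fun j _ => by rw [inner_smul_right, mul_comm]
  refine ⟨∑ j, (starRingEnd 𝕜) (d j) • v j, Submodule.sum_mem _ fun j _ =>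
    Submodule.smul_mem _ _ (Submodule.subset_span ⟨j, rfl⟩), hinner, ?_⟩
  rw [← inner_self_eq_norm_sq (𝕜 := 𝕜)]
  congr 1
  rw [sum_inner]
  refine Finset.sum_congr rfl fun i _ => ?_
  rw [inner_smul_left, hinner, RCLike.conj_conj, hd, Matrix.mulVec, dotProduct, Finset.sum_mul]
  exact Finset.sum_congr rfl fun j _ => by ring

/-- A sequence of bounded norm whose later increments are orthogonal to each of its terms is
Cauchy. -/
theorem cauchySeq_of_inner_sub_eq_zero {𝕜 H : Type*} [RCLike 𝕜]
    [NormedAddCommGroup H] [InnerProductSpace 𝕜 H] {f : ℕ → H} {C : ℝ}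
    (hC : ∀ n, ‖f n‖ ^ 2 ≤ C) (horth : ∀ m n, m ≤ n → ⟪f m, f n - f m⟫_𝕜 = 0) :
    CauchySeq f := by
  have hpyth : ∀ m n, m ≤ n → ‖f n‖ ^ 2 = ‖f m‖ ^ 2 + ‖f n - f m‖ ^ 2 := fun m n hmn => by
    have h := norm_add_sq_eq_norm_sq_add_norm_sq_of_inner_eq_zero _ _ (horth m n hmn)
    rw [add_sub_cancel] at h
    simpa only [sq] using h
  have hmono : Monotone fun n => ‖f n‖ ^ 2 := fun m n hmn => by
    have := hpyth m n hmn
    simp only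
    nlinarith [sq_nonneg ‖f n - f m‖]
  have hcauchy := (tendsto_atTop_ciSup hmono
    ⟨C, by rintro _ ⟨n, rfl⟩; exact hC n⟩).cauchySeq
  rw [Metric.cauchySeq_iff'] at hcauchy ⊢
  intro ε hε
  obtain ⟨N, hN⟩ := hcauchy (ε ^ 2) (by positivity)
  refine ⟨N, fun n hn => ?_⟩
  have h := (abs_lt.mp (hN n hn)).2
  rw [dist_eq_norm]
  refine lt_of_pow_lt_pow_left₀ 2 hε.le ?_
  linarith [hpyth N n hn]

/-- `H` is a separable Hilbert space over `𝕜 = ℝ` or `ℂ` of `𝕜`-valued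
functions on `X` with reproducing kernel `K`, with kernel sections `Kf x = K(·,x) ∈ H`, so
`K p q = ⟪Kf p, Kf q⟫` and evaluation of `f` at `x` is `f(x) = ⟪Kf x, f⟫`.
Let `(xᵢ)` be a uniqueness set (any `f ∈ H` vanishing at every `xᵢ` is `0`) with the
`K_{xᵢ}` linearly independent, and let `Γ^N` be the inverse of the Gram matrix
`G^N = [K(x_j,x_i)]`.  If `(yᵢ)` is a sequence in `𝕜` with
`sup_N Σᵢⱼ yᵢ Γ^N_{ij} conj(y_j) < ∞` (the sums are real and nonnegative; boundedness is
expressed via their real parts), then there exists a unique `F ∈ H` with `F(xᵢ) = yᵢ`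
for all `i`. -/
theorem stmt12
    {X : Type*} {𝕜 : Type*} [RCLike 𝕜]
    {H : Type*} [NormedAddCommGroup H] [InnerProductSpace 𝕜 H] [CompleteSpace H]
    [SecondCountableTopology H]
    (Kf : X → H) (K : X → X → 𝕜) (hK : ∀ p q, K p q = ⟪Kf p, Kf q⟫_𝕜)
    (x : ℕ → X)
    (huniq : ∀ f : H, (∀ i : ℕ, ⟪Kf (x i), f⟫_𝕜 = 0) → f = 0)
    (hli : LinearIndependent 𝕜 fun i : ℕ => Kf (x i))
    (y : ℕ → 𝕜)
    (hbdd : ∃ C : ℝ, ∀ N : ℕ, RCLike.re (∑ i : Fin N, ∑ j : Fin N,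
        y (i : ℕ) * (Matrix.of fun i j : Fin N => K (x (j : ℕ)) (x (i : ℕ)))⁻¹ i j
          * (starRingEnd 𝕜) (y (j : ℕ))) ≤ C) :
    ∃! F : H, ∀ i : ℕ, ⟪Kf (x i), F⟫_𝕜 = y i := by
  obtain ⟨C, hC⟩ := hbdd
  have hfin : ∀ N : ℕ, LinearIndependent 𝕜 fun i : Fin N => Kf (x i) := fun N =>
    hli.comp _ Fin.val_injective
  choose f hspan hf hnorm using fun N : ℕ =>
    exists_mem_span_inner_eq_of_linearIndependent (hfin N) fun i => y i
  have hfC : ∀ N, ‖f N‖ ^ 2 ≤ C := fun N => by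
    rw [hnorm N]
    simpa only [hK] using hC N
  have heval : ∀ N i, i < N → ⟪Kf (x i), f N⟫_𝕜 = y i := fun N i hi => hf N ⟨i, hi⟩
  have horth : ∀ m n, m ≤ n → ⟪f m, f n - f m⟫_𝕜 = 0 := fun m n hmn => by
    have hw : ∀ i : Fin m, ⟪Kf (x i), f n - f m⟫_𝕜 = 0 := fun i => by
      rw [inner_sub_right, heval n i (i.2.trans_le hmn), heval m i i.2, sub_self]
    have hm := hspan m
    generalize f n - f m = w at hw ⊢
    generalize f m = u at hm ⊢
    induction hm using Submodule.span_induction with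
    | mem g hg =>
      obtain ⟨i, rfl⟩ := hg
      exact hw i
    | zero => exact inner_zero_left _
    | add g h _ _ hg hh => rw [inner_add_left, hg, hh, add_zero]
    | smul a g _ hg => rw [inner_smul_left, hg, mul_zero]
  obtain ⟨F, hF⟩ := cauchySeq_tendsto_of_complete (cauchySeq_of_inner_sub_eq_zero hfC horth)
  have hFy : ∀ i, ⟪Kf (x i), F⟫_𝕜 = y i := fun i =>
    tendsto_nhds_unique (tendsto_const_nhds.inner hF)
      (tendsto_const_nhds.congr' ((Filter.eventually_gt_atTop i).mono fun N hN =>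
        (heval N i hN).symm))
  refine ⟨F, hFy, fun G hG => sub_eq_zero.mp (huniq _ fun i => ?_)⟩
  rw [inner_sub_right, hG, hFy, sub_self]
end

section
/- Let K(z, ζ) = 1/(1 − z·conj(ζ)) be the Szegő kernel on the open unit disc 𝔻 ⊆ ℂ and let P be the normalized Lebesgue (area) measure on 𝔻, dP = (1/π) dA. Then for all z, ζ ∈ 𝔻, (1/π) ∫_𝔻 (1 − |w|²) / ((1 − z·conj(w))(1 − w·conj(ζ))) dA(w) = Σ_{n=0}^∞ (z·conj(ζ))ⁿ / ((n+1)(n+2)); that is, the kernel K_P(z,ζ) := ∫_𝔻 K(z,w) K(w,ζ)/K(w,w) dP(w) equals Σ_{n=0}^∞ zⁿ·conj(ζ)ⁿ / ((n+1)(n+2)). -/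
open MeasureTheory

/-- Angular orthogonality: the monomial `exp (-iθ)ᵐ exp (iθ)ⁿ` integrates to `2π` on the
diagonal and to `0` off it. -/
theorem integral_conj_exp_pow_mul_exp_pow (m n : ℕ) :
    ∫ θ in Set.Ioo (-Real.pi) Real.pi,
        (Complex.exp (-(θ * Complex.I))) ^ m * (Complex.exp (θ * Complex.I)) ^ n
      = if m = n then 2 * (Real.pi : ℂ) else 0 := by
  have hexp : ∀ θ : ℝ, (Complex.exp (-(θ * Complex.I))) ^ m * (Complex.exp (θ * Complex.I)) ^ n
      = Complex.exp ((((n : ℂ) - m) * Complex.I) * θ) := by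
    intro θ
    rw [← Complex.exp_nat_mul, ← Complex.exp_nat_mul, ← Complex.exp_add]
    congr 1
    ring
  simp_rw [hexp]
  rw [← integral_Ioc_eq_integral_Ioo,
    ← intervalIntegral.integral_of_le (by linarith [Real.pi_pos])]
  split_ifs with h
  · subst h
    simp
    ring
  · have hc : ((n : ℂ) - m) * Complex.I ≠ 0 :=
      mul_ne_zero (sub_ne_zero.mpr (by exact_mod_cast Ne.symm h)) Complex.I_ne_zero
    rw [integral_exp_mul_complex hc, div_eq_zero_iff, sub_eq_zero]
    left
    rw [Complex.exp_eq_exp_iff_exists_int]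
    refine ⟨(n : ℤ) - m, ?_⟩
    push_cast
    ring

/-- Radial moments of the weight `1 - r ^ 2` on the unit disc. -/
theorem integral_Ioo_mul_one_sub_sq_mul_pow (n : ℕ) :
    ∫ r in Set.Ioo (0 : ℝ) 1, ((r * (1 - r ^ 2) * r ^ (n + n) : ℝ) : ℂ)
      = 1 / (2 * (((n : ℂ) + 1) * ((n : ℂ) + 2))) := by
  have h : ∫ r in (0 : ℝ)..1, r * (1 - r ^ 2) * r ^ (n + n)
      = 1 / (2 * (((n : ℝ) + 1) * ((n : ℝ) + 2))) := by
    have heq : ∀ r : ℝ, r * (1 - r ^ 2) * r ^ (n + n) = r ^ (2 * n + 1) - r ^ (2 * n + 3) := by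
      intro r
      ring
    simp_rw [heq]
    rw [intervalIntegral.integral_sub (by simp) (by simp), integral_pow, integral_pow]
    push_cast
    simp
    field_simp
    ring
  rw [integral_complex_ofReal, ← integral_Ioc_eq_integral_Ioo,
    ← intervalIntegral.integral_of_le zero_le_one, h]
  push_cast
  rfl

/-- Mixed moments of the weight `1 - ‖w‖ ^ 2` on the unit disc. -/
theorem integral_ball_one_sub_sq_mul_conj_pow_mul_pow (m n : ℕ) :
    ∫ w in Metric.ball (0 : ℂ) 1,
        ((1 - ‖w‖ ^ 2 : ℝ) : ℂ) * ((starRingEnd ℂ) w ^ m * w ^ n)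
      = if m = n then (Real.pi : ℂ) / (((n : ℂ) + 1) * ((n : ℂ) + 2)) else 0 := by
  rw [← integral_indicator Metric.isOpen_ball.measurableSet,
    ← Complex.integral_comp_polarCoord_symm, polarCoord_target]
  have hprod : ∀ p ∈ Set.Ioi (0 : ℝ) ×ˢ Set.Ioo (-Real.pi) Real.pi,
      p.1 • (Metric.ball (0 : ℂ) 1).indicator
        (fun w => ((1 - ‖w‖ ^ 2 : ℝ) : ℂ) * ((starRingEnd ℂ) w ^ m * w ^ n))
        (Complex.polarCoord.symm p)
      = (Set.Iio (1 : ℝ)).indicator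
          (fun r => ((r * (1 - r ^ 2) * r ^ (m + n) : ℝ) : ℂ)) p.1 *
        ((Complex.exp (-(p.2 * Complex.I))) ^ m * (Complex.exp (p.2 * Complex.I)) ^ n) := by
    rintro ⟨r, θ⟩ ⟨hr, -⟩
    have hr : 0 < r := hr
    have hw : Complex.polarCoord.symm (r, θ) = r * Complex.exp (θ * Complex.I) := by
      rw [Complex.polarCoord_symm_apply, Complex.exp_mul_I]
      push_cast
      rfl
    have hconj : (starRingEnd ℂ) (r * Complex.exp (θ * Complex.I))
        = r * Complex.exp (-(θ * Complex.I)) := by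
      rw [map_mul, ← Complex.exp_conj]
      simp
    have hnorm : ‖(r : ℂ) * Complex.exp (θ * Complex.I)‖ = r := by
      rw [norm_mul, Complex.norm_exp_ofReal_mul_I, Complex.norm_real, mul_one,
        Real.norm_of_nonneg hr.le]
    rw [hw]
    by_cases h : r < 1
    · rw [Set.indicator_of_mem (by rwa [mem_ball_zero_iff, hnorm]),
        Set.indicator_of_mem (show r ∈ Set.Iio 1 from h), hconj, hnorm, Complex.real_smul]
      push_cast
      ring
    · rw [Set.indicator_of_notMem (by rwa [mem_ball_zero_iff, hnorm]),
        Set.indicator_of_notMem (show r ∉ Set.Iio 1 from h), smul_zero, zero_mul]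
  rw [setIntegral_congr_fun (measurableSet_Ioi.prod measurableSet_Ioo) hprod,
    Measure.volume_eq_prod]
  rw [setIntegral_prod_mul (μ := volume) (ν := volume)
    ((Set.Iio (1 : ℝ)).indicator (fun r => ((r * (1 - r ^ 2) * r ^ (m + n) : ℝ) : ℂ)))
    (fun θ : ℝ => (Complex.exp (-(θ * Complex.I))) ^ m * (Complex.exp (θ * Complex.I)) ^ n),
    integral_conj_exp_pow_mul_exp_pow, setIntegral_indicator measurableSet_Iio,
    Set.Ioi_inter_Iio]
  split_ifs with h
  · subst h
    rw [integral_Ioo_mul_one_sub_sq_mul_pow]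
    field_simp
  · rw [mul_zero]

theorem stmt17 (z ζ : ℂ) (hz : ‖z‖ < 1) (hζ : ‖ζ‖ < 1) :
    ((Real.pi : ℂ))⁻¹ * ∫ w in Metric.ball (0 : ℂ) 1,
        ((1 - ‖w‖ ^ 2 : ℝ) : ℂ)
          / ((1 - z * (starRingEnd ℂ) w) * (1 - w * (starRingEnd ℂ) ζ)) ∂volume
      = ∑' n : ℕ, (z * (starRingEnd ℂ) ζ) ^ n / (((n : ℂ) + 1) * ((n : ℂ) + 2)) := by
  have hbound : Summable fun p : ℕ × ℕ => ‖z‖ ^ p.1 * ‖ζ‖ ^ p.2 :=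
    (summable_geometric_of_lt_one (norm_nonneg z) hz).mul_of_nonneg
      (summable_geometric_of_lt_one (norm_nonneg ζ) hζ)
      (fun _ => by positivity) (fun _ => by positivity)
  have hsum := hasSum_integral_of_dominated_convergence
    (μ := volume.restrict (Metric.ball (0 : ℂ) 1))
    (F := fun (p : ℕ × ℕ) (w : ℂ) => (z ^ p.1 * (starRingEnd ℂ) ζ ^ p.2) *
      (((1 - ‖w‖ ^ 2 : ℝ) : ℂ) * ((starRingEnd ℂ) w ^ p.1 * w ^ p.2)))
    (f := fun w => ((1 - ‖w‖ ^ 2 : ℝ) : ℂ)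
      / ((1 - z * (starRingEnd ℂ) w) * (1 - w * (starRingEnd ℂ) ζ)))
    (fun p _ => ‖z‖ ^ p.1 * ‖ζ‖ ^ p.2)
    (fun p => by
      have := Complex.continuous_conj
      exact Continuous.aestronglyMeasurable (by fun_prop))
    (fun p => by
      filter_upwards [ae_restrict_mem Metric.isOpen_ball.measurableSet] with w hw
      rw [mem_ball_zero_iff] at hw
      have h1 : |1 - ‖w‖ ^ 2| ≤ 1 := by
        rw [abs_le]
        constructor <;> nlinarith [norm_nonneg w]
      have h2 : ‖w‖ ^ p.1 * ‖w‖ ^ p.2 ≤ 1 :=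
        mul_le_one₀ (pow_le_one₀ (norm_nonneg w) hw.le) (by positivity)
          (pow_le_one₀ (norm_nonneg w) hw.le)
      simp only [norm_mul, norm_pow, RCLike.norm_conj, Complex.norm_real, Real.norm_eq_abs]
      exact mul_le_of_le_one_right (by positivity) (mul_le_one₀ h1 (by positivity) h2))
    (Filter.Eventually.of_forall fun _ => hbound)
    (integrableOn_const measure_ball_lt_top.ne)
    (by
      filter_upwards [ae_restrict_mem Metric.isOpen_ball.measurableSet] with w hw
      rw [mem_ball_zero_iff] at hw
      have ha : ‖z * (starRingEnd ℂ) w‖ < 1 := by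
        rw [norm_mul, RCLike.norm_conj]
        exact mul_lt_one_of_nonneg_of_lt_one_left (norm_nonneg z) hz hw.le
      have hb : ‖w * (starRingEnd ℂ) ζ‖ < 1 := by
        rw [norm_mul, RCLike.norm_conj]
        exact mul_lt_one_of_nonneg_of_lt_one_left (norm_nonneg w) hw hζ.le
      have h := ((hasSum_geometric_of_norm_lt_one ha).mul
        (hasSum_geometric_of_norm_lt_one hb) (summable_mul_of_summable_norm
          (summable_norm_geometric_of_norm_lt_one ha)
          (summable_norm_geometric_of_norm_lt_one hb))).mul_left
        ((1 - ‖w‖ ^ 2 : ℝ) : ℂ)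
      rw [← mul_inv, ← div_eq_mul_inv] at h
      refine h.congr_fun ?_
      intro p
      ring)
  simp_rw [integral_const_mul, integral_ball_one_sub_sq_mul_conj_pow_mul_pow] at hsum
  have hinj : Function.Injective fun n : ℕ => (n, n) := fun a b h => congrArg Prod.fst h
  rw [← hinj.hasSum_iff (by
    rintro ⟨m, n⟩ hmn
    have : m ≠ n := by
      rintro rfl
      exact hmn ⟨m, rfl⟩
    simp [this])] at hsum
  rw [← (hsum.mul_left (Real.pi : ℂ)⁻¹).tsum_eq]
  have hpi : (Real.pi : ℂ) ≠ 0 := by exact_mod_cast Real.pi_ne_zero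
  refine tsum_congr fun n => ?_
  simp only [Function.comp_apply, if_true]
  rw [mul_pow]
  field_simp
end
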